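/- arXiv:math/0209252 — 8 statements merged into one kernel-verified Lean document; each statement's English description precedes it below -/
import Mathlib

section
/- Let p, q, r be elements of a semigroup Q. Then: (i) if q ≤_L p and p ∈ H(Q), then qp R q; (ii) if q ≤_L p, r ≤_L p, p ∈ H(Q) and qp = rp, then q = r; (iii) if q ≤_L p, r ≤_L p, p ∈ H(Q) and qp L rp, then q L r; (iv) if q ≤_R p and q ∈ H(Q), then qp R q; (v) if q R p and p ∈ H(Q), then pq H q. -/
universe u

variable {Q : Type u}

/-- `p ≤_L q` in a semigroup `Q`: `Q¹p ⊆ Q¹q`, i.e. `p = q` or `p = x*q` for some `x`. -/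
def leL [Semigroup Q] (p q : Q) : Prop := p = q ∨ ∃ x, p = x * q

/-- `p ≤_R q` in a semigroup `Q`: `pQ¹ ⊆ qQ¹`. -/
def leR [Semigroup Q] (p q : Q) : Prop := p = q ∨ ∃ x, p = q * x

/-- Green's relation `L`. -/
def GreenL [Semigroup Q] (p q : Q) : Prop := leL p q ∧ leL q p

/-- Green's relation `R`. -/
def GreenR [Semigroup Q] (p q : Q) : Prop := leR p q ∧ leR q p

/-- Green's relation `H = L ∩ R`. -/
def GreenH [Semigroup Q] (p q : Q) : Prop := GreenL p q ∧ GreenR p q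

/-- Green's relation `D = L ∘ R`. -/
def GreenD [Semigroup Q] (p q : Q) : Prop := ∃ c, GreenL p c ∧ GreenR c q

/-- `h` is the group inverse `q♯` of `q` (in the group `H`-class of `q`):
`q` and `h` commute, `qhq = q` and `hqh = h`.  This holds precisely when `q` lies in a
subgroup of `Q` and `h` is its group inverse there. -/
def IsGroupInverse [Semigroup Q] (q h : Q) : Prop :=
  q * h = h * q ∧ q * h * q = q ∧ h * q * h = h

/-- `q` lies in a subgroup of `Q` (i.e. `q ∈ H(Q)`, the `H`-class of `q` is a group). -/
def inSubgroup [Semigroup Q] (q : Q) : Prop := ∃ h, IsGroupInverse q h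

/-- A semigroup is regular if every element `q` can be written `q = qxq`. -/
def Regular (Q : Type u) [Semigroup Q] : Prop := ∀ q : Q, ∃ x, q * x * q = q

theorem leR_refl [Semigroup Q] (a : Q) : leR a a := Or.inl rfl

theorem leR_mul_right [Semigroup Q] (a b : Q) : leR (a * b) a := Or.inr ⟨b, rfl⟩

theorem leL_mul_left [Semigroup Q] (a b : Q) : leL (a * b) b := Or.inr ⟨a, rfl⟩

theorem leR_trans [Semigroup Q] {a b c : Q} (hab : leR a b) (hbc : leR b c) : leR a c := by
  rcases hab with rfl | ⟨x, rfl⟩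
  · exact hbc
  · rcases hbc with rfl | ⟨y, rfl⟩
    · exact leR_mul_right b x
    · exact Or.inr ⟨y * x, mul_assoc c y x⟩

theorem leR_mul_mul_left [Semigroup Q] {a b : Q} (c : Q) (h : leR a b) :
    leR (c * a) (c * b) := by
  rcases h with rfl | ⟨x, rfl⟩
  · exact leR_refl _
  · exact Or.inr ⟨x, (mul_assoc c b x).symm⟩

theorem leL_mul_mul_right [Semigroup Q] {a b : Q} (c : Q) (h : leL a b) :
    leL (a * c) (b * c) := by
  rcases h with rfl | ⟨x, rfl⟩
  · exact Or.inl rfl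
  · exact Or.inr ⟨x, mul_assoc x b c⟩

theorem IsGroupInverse.mul_mul_cancel_right [Semigroup Q] {p k q : Q} (hk : IsGroupInverse p k)
    (hq : leL q p) : q * p * k = q := by
  obtain ⟨hcomm, hpkp, -⟩ := hk
  have hp : p * p * k = p := by rw [mul_assoc, hcomm, ← mul_assoc, hpkp]
  rcases hq with rfl | ⟨x, rfl⟩
  · exact hp
  · rw [mul_assoc x, mul_assoc x, hp]

theorem IsGroupInverse.mul_mul_cancel_left [Semigroup Q] {p k q : Q} (hk : IsGroupInverse p k)
    (hq : leR q p) : k * (p * q) = q := by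
  obtain ⟨hcomm, hpkp, -⟩ := hk
  rw [← mul_assoc, ← hcomm]
  rcases hq with rfl | ⟨x, rfl⟩
  · exact hpkp
  · rw [← mul_assoc, hpkp]

theorem IsGroupInverse.leR_mul_self [Semigroup Q] {p k : Q} (hk : IsGroupInverse p k) :
    leR p (p * p) :=
  Or.inr ⟨k, (hk.mul_mul_cancel_right (Or.inl rfl)).symm⟩

theorem IsGroupInverse.leL_of_leL_mul [Semigroup Q] {p k q r : Q} (hk : IsGroupInverse p k)
    (hq : leL q p) (hr : leL r p) (h : leL (q * p) (r * p)) : leL q r := by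
  have := leL_mul_mul_right k h
  rwa [hk.mul_mul_cancel_right hq, hk.mul_mul_cancel_right hr] at this

/-- Lemma 2.1 of Gould, "Semigroups of left quotients: existence, straightness and
locality".  Let `p, q, r` be elements of a semigroup `Q`. Then:
(i) if `q ≤_L p` and `p ∈ H(Q)`, then `qp R q`;
(ii) if `q ≤_L p`, `r ≤_L p`, `p ∈ H(Q)` and `qp = rp`, then `q = r`;
(iii) if `q ≤_L p`, `r ≤_L p`, `p ∈ H(Q)` and `qp L rp`, then `q L r`;
(iv) if `q ≤_R p` and `q ∈ H(Q)`, then `qp R q`;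
(v) if `q R p` and `p ∈ H(Q)`, then `pq H q`. -/
theorem green_lemma {Q : Type u} [Semigroup Q] (p q r : Q) :
    (leL q p → inSubgroup p → GreenR (q * p) q) ∧
    (leL q p → leL r p → inSubgroup p → q * p = r * p → q = r) ∧
    (leL q p → leL r p → inSubgroup p → GreenL (q * p) (r * p) → GreenL q r) ∧
    (leR q p → inSubgroup q → GreenR (q * p) q) ∧
    (GreenR q p → inSubgroup p → GreenH (p * q) q) := by
  refine ⟨?_, ?_, ?_, ?_, ?_⟩
  · rintro hq ⟨k, hk⟩
    exact ⟨leR_mul_right q p, Or.inr ⟨k, (hk.mul_mul_cancel_right hq).symm⟩⟩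
  · rintro hq hr ⟨k, hk⟩ h
    rw [← hk.mul_mul_cancel_right hq, h, hk.mul_mul_cancel_right hr]
  · rintro hq hr ⟨k, hk⟩ ⟨hqr, hrq⟩
    exact ⟨hk.leL_of_leL_mul hq hr hqr, hk.leL_of_leL_mul hr hq hrq⟩
  · rintro hq ⟨k, hk⟩
    exact ⟨leR_mul_right q p, leR_trans hk.leR_mul_self (leR_mul_mul_left q hq)⟩
  · rintro ⟨hqp, hpq⟩ ⟨k, hk⟩
    exact ⟨⟨leL_mul_left p q, Or.inr ⟨k, (hk.mul_mul_cancel_left hqp).symm⟩⟩,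
      leR_trans (leR_mul_right p q) hpq,
      leR_trans hqp (leR_trans hk.leR_mul_self (leR_mul_mul_left p hpq))⟩
end

section
/- Let S be a subsemigroup of a regular semigroup Q. The following conditions are equivalent: (i) S is a very large weak left order in Q; (ii) S is a straight weak left order in Q; (iii) S is a very large local left order in Q. -/
universe u

variable {Q : Type u}

/-- `S` is a weak left order in `Q`: every element of `Q` is `a♯ * b` with `a, b ∈ S`. -/
def IsWeakLeftOrder [Semigroup Q] (S : Set Q) : Prop :=
  ∀ q : Q, ∃ a ∈ S, ∃ b ∈ S, ∃ c, IsGroupInverse a c ∧ q = c * b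

/-- `S` is a straight weak left order in `Q`: every element of `Q` is `a♯ * b` with
`a, b ∈ S` and `a R b` in `Q`. -/
def IsStraightWeakLeftOrder [Semigroup Q] (S : Set Q) : Prop :=
  ∀ q : Q, ∃ a ∈ S, ∃ b ∈ S, (∃ c, IsGroupInverse a c ∧ q = c * b) ∧ GreenR a b

/-- `S` is a weak right order in `Q`: every element of `Q` is `b * a♯` with `a, b ∈ S`. -/
def IsWeakRightOrder [Semigroup Q] (S : Set Q) : Prop :=
  ∀ q : Q, ∃ a ∈ S, ∃ b ∈ S, ∃ c, IsGroupInverse a c ∧ q = b * c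

/-- `S` is a straight weak right order in `Q`: every element of `Q` is `b * a♯` with
`a, b ∈ S` and `a L b` in `Q`. -/
def IsStraightWeakRightOrder [Semigroup Q] (S : Set Q) : Prop :=
  ∀ q : Q, ∃ a ∈ S, ∃ b ∈ S, (∃ c, IsGroupInverse a c ∧ q = b * c) ∧ GreenL a b

/-- `S` is very large in `Q`: it meets every `H`-class of `Q`. -/
def VeryLarge [Semigroup Q] (S : Set Q) : Prop := ∀ q : Q, ∃ s ∈ S, GreenH s q

/-- `S` is a local left order in `Q`: for every group `H`-class (the `H`-class of an
element `e` lying in a subgroup), every element of that `H`-class is `a⁻¹ * b` for some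
`a, b ∈ S` lying in that `H`-class, `a⁻¹` being the group inverse of `a`. -/
def IsLocalLeftOrder [Semigroup Q] (S : Set Q) : Prop :=
  ∀ e : Q, inSubgroup e → ∀ q : Q, GreenH q e →
    ∃ a ∈ S, ∃ b ∈ S, GreenH a e ∧ GreenH b e ∧ ∃ c, IsGroupInverse a c ∧ q = c * b

/-- `x` and `h` are mutually inverse units of the local monoid `eQe`. -/
structure InverseAt [Semigroup Q] (e x h : Q) : Prop where
  mul_inv : x * h = e
  inv_mul : h * x = e
  id_mul : e * x = x
  mul_id : x * e = x
  id_mul_inv : e * h = h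
  inv_mul_id : h * e = h

namespace InverseAt

variable [Semigroup Q] {e x y h k : Q}

theorem of_factors (h₁ : e * x = x) (h₂ : x * e = x) (h₃ : ∃ k, e = x * k)
    (h₄ : ∃ m, e = m * x) : ∃ h, InverseAt e x h := by
  obtain ⟨k, hk⟩ := h₃
  obtain ⟨m, hm⟩ := h₄
  have hee : e * e = e := by
    calc e * e = e * x * k := by rw [mul_assoc, ← hk]
      _ = e := by rw [h₁, ← hk]
  have hxh : x * (e * k * e) = e := by
    rw [← mul_assoc, ← mul_assoc, h₂, ← hk, hee]
  have heh : e * (e * k * e) = e * k * e := by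
    rw [← mul_assoc, ← mul_assoc, hee]
  refine ⟨e * k * e, hxh, ?_, h₁, h₂, heh, by rw [mul_assoc, hee]⟩
  have hme : e * k * e = m * e := by
    rw [← heh]
    nth_rewrite 1 [hm]
    rw [mul_assoc, hxh]
  rw [hme, mul_assoc, h₁, ← hm]

theorem isGroupInverse (hx : InverseAt e x h) : IsGroupInverse x h := by
  refine ⟨by rw [hx.mul_inv, hx.inv_mul], by rw [hx.mul_inv, hx.id_mul],
    by rw [hx.inv_mul, hx.id_mul_inv]⟩

theorem symm (hx : InverseAt e x h) : InverseAt e h x :=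
  ⟨hx.inv_mul, hx.mul_inv, hx.id_mul_inv, hx.inv_mul_id, hx.id_mul, hx.mul_id⟩

theorem mul (hx : InverseAt e x h) (hy : InverseAt e y k) :
    InverseAt e (x * y) (k * h) where
  mul_inv := by rw [mul_assoc, ← mul_assoc y, hy.mul_inv, hx.id_mul_inv, hx.mul_inv]
  inv_mul := by rw [mul_assoc, ← mul_assoc h, hx.inv_mul, hy.id_mul, hy.inv_mul]
  id_mul := by rw [← mul_assoc, hx.id_mul]
  mul_id := by rw [mul_assoc, hy.mul_id]
  id_mul_inv := by rw [← mul_assoc, hy.id_mul_inv]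
  inv_mul_id := by rw [mul_assoc, hx.inv_mul_id]

theorem greenH (hx : InverseAt e x h) (hy : InverseAt e y k) : GreenH x y := by
  refine ⟨⟨Or.inr ⟨x * k, ?_⟩, Or.inr ⟨y * h, ?_⟩⟩, ⟨Or.inr ⟨k * x, ?_⟩, Or.inr ⟨h * y, ?_⟩⟩⟩
  · rw [mul_assoc, hy.inv_mul, hx.mul_id]
  · rw [mul_assoc, hx.inv_mul, hy.mul_id]
  · rw [← mul_assoc, hy.mul_inv, hx.id_mul]
  · rw [← mul_assoc, hx.mul_inv, hy.id_mul]

theorem of_isGroupInverse (hx : IsGroupInverse x h) : InverseAt (x * h) x h where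
  mul_inv := rfl
  inv_mul := hx.1.symm
  id_mul := hx.2.1
  mul_id := by rw [hx.1, ← mul_assoc, hx.2.1]
  id_mul_inv := by rw [hx.1, hx.2.2]
  inv_mul_id := by rw [← mul_assoc, hx.2.2]

end InverseAt

section Green

variable [Semigroup Q]

theorem Regular.leL_iff (hQ : Regular Q) {p q : Q} : leL p q ↔ ∃ x, p = x * q := by
  refine ⟨?_, Or.inr⟩
  rintro (rfl | h)
  · obtain ⟨x, hx⟩ := hQ p
    exact ⟨p * x, hx.symm⟩
  · exact h

theorem Regular.leR_iff (hQ : Regular Q) {p q : Q} : leR p q ↔ ∃ x, p = q * x := by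
  refine ⟨?_, Or.inr⟩
  rintro (rfl | h)
  · obtain ⟨x, hx⟩ := hQ p
    exact ⟨x * p, by rw [← mul_assoc, hx]⟩
  · exact h

theorem InverseAt.exists_of_greenH (hQ : Regular Q) {e x y h : Q} (hx : InverseAt e x h)
    (hyx : GreenH y x) : ∃ k, InverseAt e y k := by
  obtain ⟨⟨h₁, h₂⟩, h₃, h₄⟩ := hyx
  rw [hQ.leL_iff] at h₁ h₂
  rw [hQ.leR_iff] at h₃ h₄
  obtain ⟨p, hp⟩ := h₁
  obtain ⟨q, hq⟩ := h₂
  obtain ⟨r, hr⟩ := h₃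
  obtain ⟨s, hs⟩ := h₄
  refine InverseAt.of_factors ?_ ?_ ⟨s * h, ?_⟩ ⟨h * q, ?_⟩
  · rw [hr, ← mul_assoc, hx.id_mul]
  · rw [hp, mul_assoc, hx.mul_id]
  · rw [← mul_assoc, ← hs, hx.mul_inv]
  · rw [mul_assoc, ← hq, hx.inv_mul]

/-- If `c` is the group inverse of `a` and `a R b`, then `b H c * b`. -/
theorem IsGroupInverse.greenH_mul (hQ : Regular Q) {a b c : Q} (hac : IsGroupInverse a c)
    (hab : GreenR a b) : GreenH b (c * b) ∧ a * (c * b) = b := by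
  obtain ⟨h₁, h₂⟩ := hab
  rw [hQ.leR_iff] at h₁ h₂
  obtain ⟨m, hm⟩ := h₁
  obtain ⟨k, hk⟩ := h₂
  have hA := InverseAt.of_isGroupInverse hac
  have hb : a * (c * b) = b := by
    rw [hk, ← mul_assoc, ← mul_assoc, hA.id_mul]
  refine ⟨⟨⟨Or.inr ⟨a, hb.symm⟩, Or.inr ⟨c, rfl⟩⟩, Or.inr ⟨m * a * k, ?_⟩,
    Or.inr ⟨m * c * k, ?_⟩⟩, hb⟩
  · calc b = a * c * a * k := by rw [hA.id_mul, ← hk]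
      _ = c * a * a * k := by rw [hac.1]
      _ = c * (b * m) * a * k := by rw [← hm]
      _ = c * b * (m * a * k) := by simp only [mul_assoc]
  · calc c * b = c * a * k := by rw [mul_assoc, ← hk]
      _ = a * c * k := by rw [hac.1]
      _ = b * m * c * k := by rw [← hm]
      _ = b * (m * c * k) := by simp only [mul_assoc]

end Green

section Orders

variable [Semigroup Q] {S : Subsemigroup Q}

theorem IsStraightWeakLeftOrder.isWeakLeftOrder
    (hS : IsStraightWeakLeftOrder (S : Set Q)) : IsWeakLeftOrder (S : Set Q) := fun q => by
  obtain ⟨a, ha, b, hb, h, -⟩ := hS q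
  exact ⟨a, ha, b, hb, h⟩

theorem IsStraightWeakLeftOrder.veryLarge (hQ : Regular Q)
    (hS : IsStraightWeakLeftOrder (S : Set Q)) : VeryLarge (S : Set Q) := fun q => by
  obtain ⟨a, -, b, hb, ⟨c, hac, rfl⟩, hab⟩ := hS q
  exact ⟨b, hb, (hac.greenH_mul hQ hab).1⟩

theorem IsStraightWeakLeftOrder.exists_mul_mem (hQ : Regular Q)
    (hS : IsStraightWeakLeftOrder (S : Set Q)) {e q r : Q} (hq : InverseAt e q r) :
    ∃ a ∈ S, a * q ∈ S ∧ ∃ i, InverseAt e (a * e) i := by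
  obtain ⟨a, ha, b, hb, ⟨c, hac, rfl⟩, hab⟩ := hS q
  obtain ⟨hH, hab'⟩ := hac.greenH_mul hQ hab
  obtain ⟨k, hk⟩ := hq.exists_of_greenH hQ hH
  have hA := InverseAt.of_isGroupInverse hac
  have hea : e * a = a := by
    obtain ⟨m, hm⟩ := hQ.leR_iff.1 hab.1
    rw [hm, ← mul_assoc, hk.id_mul]
  have hee : e * e = e := by rw [← hk.mul_inv, ← mul_assoc, hk.mul_inv, hk.id_mul, hk.mul_inv]
  have hace : a * c * e = e := by
    rw [← hk.mul_inv, ← mul_assoc, mul_assoc a c b, hab', hk.mul_inv]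
  refine ⟨a, ha, by rwa [hab'], InverseAt.of_factors ?_ ?_ ⟨c * e, ?_⟩ ⟨c, ?_⟩⟩
  · rw [← mul_assoc, hea]
  · rw [mul_assoc, hee]
  · have hec : e * c = c := by
      rw [← hA.id_mul_inv, ← mul_assoc, ← mul_assoc, hea]
    rw [mul_assoc, ← mul_assoc e, hec, ← mul_assoc, hace]
  · rw [← mul_assoc, ← hac.1, hace]

theorem IsStraightWeakLeftOrder.isLocalLeftOrder (hQ : Regular Q)
    (hS : IsStraightWeakLeftOrder (S : Set Q)) : IsLocalLeftOrder (S : Set Q) := by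
  rintro g ⟨g', hg⟩ q hqg
  have hG := InverseAt.of_isGroupInverse hg
  set e := g * g'
  obtain ⟨r, hq⟩ := hG.exists_of_greenH hQ hqg
  obtain ⟨s, hsS, hsg⟩ := hS.veryLarge hQ g
  obtain ⟨t, hs⟩ := hG.exists_of_greenH hQ hsg
  obtain ⟨a, -, haq, i, hi⟩ := hS.exists_mul_mem hQ hq
  obtain ⟨c, hc, hcw, j, hj⟩ := hS.exists_mul_mem hQ (hs.mul hi.symm)
  have hu : InverseAt e (c * s) (t * j) := by
    have := hj.mul hs
    rwa [mul_assoc c, hs.id_mul] at this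
  have hprod : c * (s * i) * (a * q) = c * s * q := by
    calc c * (s * i) * (a * q) = c * (s * i) * (a * (e * q)) := by rw [hq.id_mul]
      _ = c * s * (i * (a * e) * q) := by simp only [mul_assoc]
      _ = c * s * q := by rw [hi.inv_mul, hq.id_mul]
  refine ⟨c * s, S.mul_mem hc hsS, c * s * q, hprod ▸ S.mul_mem hcw haq, hu.greenH hG,
    (hu.mul hq).greenH hG, t * j, hu.isGroupInverse, ?_⟩
  rw [← mul_assoc, hu.inv_mul, hq.id_mul]

theorem IsLocalLeftOrder.isStraightWeakLeftOrder (hQ : Regular Q)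
    (hV : VeryLarge (S : Set Q)) (hS : IsLocalLeftOrder (S : Set Q)) :
    IsStraightWeakLeftOrder (S : Set Q) := by
  intro q
  obtain ⟨x, hx⟩ := hQ q
  obtain ⟨e, he⟩ : ∃ e, e = q * x := ⟨_, rfl⟩
  rw [← he] at hx
  have hee : e * e = e := by
    nth_rewrite 2 [he]
    rw [← mul_assoc, hx, ← he]
  obtain ⟨s, hsS, ⟨h₁, h₂⟩, h₃, h₄⟩ := hV q
  rw [hQ.leL_iff] at h₁ h₂
  rw [hQ.leR_iff] at h₃ h₄
  obtain ⟨y', hy'⟩ := h₁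
  obtain ⟨y, hy⟩ := h₂
  obtain ⟨n, hn⟩ := h₃
  obtain ⟨l, hl⟩ := h₄
  have hes : e * s = s := by rw [hn, ← mul_assoc, hx]
  obtain ⟨z, hz⟩ : ∃ z, e = s * z := ⟨l * x, by rw [← mul_assoc, ← hl, he]⟩
  have hqzs : q * z * s = q := by
    calc q * z * s = y * (s * z * s) := by rw [hy]; simp only [mul_assoc]
      _ = q := by rw [← hz, hes, ← hy]
  have hsxq : s * x * q = s := by
    calc s * x * q = y' * (q * x * q) := by rw [hy']; simp only [mul_assoc]
      _ = s := by rw [← he, hx, ← hy']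
  obtain ⟨k, hg⟩ : ∃ k, InverseAt e (q * z * e) k := by
    refine InverseAt.of_factors ?_ ?_ ⟨s * x, ?_⟩ ⟨s * x, ?_⟩
    · rw [← mul_assoc, ← mul_assoc, hx]
    · rw [mul_assoc, hee]
    · calc e = q * z * s * x := by rw [hqzs, he]
        _ = q * z * (e * s) * x := by rw [hes]
        _ = q * z * e * (s * x) := by simp only [mul_assoc]
    · calc e = s * x * q * z * e := by rw [hsxq, ← hz, hee]
        _ = s * x * (q * z * e) := by simp only [mul_assoc]
  have hE : InverseAt e e e := ⟨hee, hee, hee, hee, hee, hee⟩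
  obtain ⟨a, ha, b, hb, hae, hbe, c, hac, hc⟩ := hS e ⟨e, hE.isGroupInverse⟩ _ (hg.greenH hE)
  obtain ⟨a', ha'⟩ := hE.exists_of_greenH hQ hae
  obtain ⟨b', hb'⟩ := hE.exists_of_greenH hQ hbe
  refine ⟨a, ha, b * s, S.mul_mem hb hsS, ⟨c, hac, ?_⟩,
    Or.inr ⟨z * b' * a, ?_⟩, Or.inr ⟨a' * b * s, ?_⟩⟩
  · rw [← mul_assoc, ← hc, mul_assoc, hes, hqzs]
  · calc a = b * e * b' * a := by rw [hb'.mul_id, hb'.mul_inv, ha'.id_mul]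
      _ = b * s * (z * b' * a) := by rw [hz]; simp only [mul_assoc]
  · rw [← mul_assoc, ← mul_assoc, ha'.mul_inv, hb'.id_mul]

theorem IsWeakLeftOrder.isStraightWeakLeftOrder (hQ : Regular Q)
    (hV : VeryLarge (S : Set Q)) (hS : IsWeakLeftOrder (S : Set Q)) :
    IsStraightWeakLeftOrder (S : Set Q) := by
  intro q
  obtain ⟨x, hx⟩ := hQ q
  obtain ⟨e, he⟩ : ∃ e, e = q * x := ⟨_, rfl⟩
  rw [← he] at hx
  have hee : e * e = e := by
    nth_rewrite 2 [he]
    rw [← mul_assoc, hx, ← he]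
  obtain ⟨a₀, ha₀, b₀, hb₀, c₀, hac₀, hq₀⟩ := hS q
  obtain ⟨a, ha, b, hb, a', hA, hq, hb'⟩ : ∃ a ∈ S, ∃ b ∈ S, ∃ a', InverseAt (a * a') a a' ∧
      q = a' * b ∧ a * q = b := by
    have h₀ := InverseAt.of_isGroupInverse hac₀
    have h₁ := h₀.mul h₀
    rw [← h₁.mul_inv] at h₁
    refine ⟨_, S.mul_mem ha₀ ha₀, a₀ * b₀, S.mul_mem ha₀ hb₀, _, h₁, ?_, ?_⟩
    · rw [mul_assoc c₀, ← mul_assoc c₀ a₀, h₀.inv_mul, ← mul_assoc, h₀.inv_mul_id, hq₀]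
    · rw [hq₀, mul_assoc a₀, ← mul_assoc a₀ c₀, ← mul_assoc, h₀.mul_id]
  obtain ⟨f, hf⟩ : ∃ f, f = a * a' := ⟨_, rfl⟩
  rw [← hf] at hA
  have hfq : f * q = q := by rw [hq, ← mul_assoc, hA.id_mul_inv]
  have hfe : f * e = e := by rw [he, ← mul_assoc, hfq]
  obtain ⟨t, htS, ⟨h₁, h₂⟩, h₃, h₄⟩ := hV (e * a')
  rw [hQ.leL_iff] at h₁ h₂
  rw [hQ.leR_iff] at h₃ h₄
  obtain ⟨u, hu⟩ := h₁
  obtain ⟨v, hv⟩ := h₂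
  obtain ⟨n, hn⟩ := h₃
  obtain ⟨w, hw⟩ := h₄
  have het : e * t = t := by rw [hn, ← mul_assoc, ← mul_assoc, hee]
  have hta : t * a = u * (e * f) := by
    rw [hu, mul_assoc, mul_assoc, hA.inv_mul]
  have htf : t * f = t := by
    rw [hu, mul_assoc, mul_assoc, hA.inv_mul_id]
  have hef : e * f = e * a' * a := by rw [mul_assoc, hA.inv_mul]
  have heff : e * f * (e * f) = e * f := by
    rw [mul_assoc, ← mul_assoc f, hfe, ← mul_assoc, hee]
  obtain ⟨c, hc⟩ : ∃ c, InverseAt (e * f) (t * a) c := by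
    refine InverseAt.of_factors ?_ ?_ ⟨a' * w * a, ?_⟩ ⟨v, ?_⟩
    · calc e * f * (t * a) = e * (f * e) * t * a := by
            nth_rewrite 1 [← het]; simp only [mul_assoc]
        _ = t * a := by rw [hfe, hee, het]
    · rw [hta, mul_assoc, heff]
    · calc e * f = t * w * a := by rw [hef, hw]
        _ = t * f * w * a := by rw [htf]
        _ = t * a * (a' * w * a) := by rw [hf]; simp only [mul_assoc]
    · rw [← mul_assoc, ← hv, hef]
  have htb : t * b = t * a * q := by rw [mul_assoc, hb']
  refine ⟨t * a, S.mul_mem htS ha, t * b, S.mul_mem htS hb, ⟨c, hc.isGroupInverse, ?_⟩,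
    Or.inr ⟨x * f, ?_⟩, Or.inr ⟨q, htb⟩⟩
  · rw [htb, ← mul_assoc, hc.inv_mul, mul_assoc, hfq, hx]
  · calc t * a = t * a * (e * f) := hc.mul_id.symm
      _ = t * b * (x * f) := by rw [htb, he]; simp only [mul_assoc]

end Orders

/-- Proposition 3.1: for a subsemigroup `S` of a regular semigroup `Q`, the following are
equivalent: (i) `S` is a very large weak left order in `Q`; (ii) `S` is a straight weak
left order in `Q`; (iii) `S` is a very large local left order in `Q`. -/
theorem very_large_iff_straight_iff_local {Q : Type u} [Semigroup Q] (hQ : Regular Q)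
    (S : Subsemigroup Q) :
    ((VeryLarge (S : Set Q) ∧ IsWeakLeftOrder (S : Set Q)) ↔
      IsStraightWeakLeftOrder (S : Set Q)) ∧
    (IsStraightWeakLeftOrder (S : Set Q) ↔
      (VeryLarge (S : Set Q) ∧ IsLocalLeftOrder (S : Set Q))) := by
  exact ⟨⟨fun h => h.2.isStraightWeakLeftOrder hQ h.1,
      fun h => ⟨h.veryLarge hQ, h.isWeakLeftOrder⟩⟩,
    fun h => ⟨h.veryLarge hQ, h.isLocalLeftOrder hQ⟩,
    fun h => h.2.isStraightWeakLeftOrder hQ h.1⟩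
end

section
/- Let Q be a regular semigroup all of whose subgroups are abelian, and let S be a subsemigroup of Q. Then S is a straight weak left order in Q if and only if S is a straight weak right order in Q. -/
universe u

variable {Q : Type u}

/-- `h` is the inverse of `g` in the group of units of the local monoid `eQe`. -/
structure IsLocalInverse [Semigroup Q] (e g h : Q) : Prop where
  id_mul : e * g = g
  mul_id : g * e = g
  id_mul_inv : e * h = h
  inv_mul_id : h * e = h
  mul_inv : g * h = e
  inv_mul : h * g = e

namespace IsLocalInverse

variable [Semigroup Q] {e g h d k : Q}

theorem symm (H : IsLocalInverse e g h) : IsLocalInverse e h g :=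
  ⟨H.3, H.4, H.1, H.2, H.6, H.5⟩

theorem mul (H : IsLocalInverse e g h) (K : IsLocalInverse e d k) :
    IsLocalInverse e (g * d) (k * h) where
  id_mul := by rw [← mul_assoc, H.id_mul]
  mul_id := by rw [mul_assoc, K.mul_id]
  id_mul_inv := by rw [← mul_assoc, K.id_mul_inv]
  inv_mul_id := by rw [mul_assoc, H.inv_mul_id]
  mul_inv := by rw [mul_assoc, ← mul_assoc d, K.mul_inv, H.id_mul_inv, H.mul_inv]
  inv_mul := by rw [mul_assoc, ← mul_assoc h, H.inv_mul, K.id_mul, K.inv_mul]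

theorem exists_of_left_right {l r : Q} (he : e * e = e) (heg : e * g = g) (hge : g * e = g)
    (hr : g * r = e) (hl : l * g = e) : ∃ h, IsLocalInverse e g h := by
  have h1 : e * l * e = e * r * e :=
    calc e * l * e = e * l * (g * r) := by rw [hr]
      _ = e * (l * g) * r := by simp only [mul_assoc]
      _ = e * r := by rw [hl, he]
      _ = e * ((l * g) * r) := by rw [hl, ← mul_assoc, he]
      _ = e * (l * (g * r) * e) := by rw [mul_assoc l g r, hr, mul_assoc l e e, he]
      _ = e * ((l * g) * r * e) := by simp only [mul_assoc]
      _ = e * r * e := by rw [hl, ← mul_assoc, ← mul_assoc, he]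
  refine ⟨e * r * e, heg, hge, ?_, ?_, ?_, ?_⟩
  · rw [← mul_assoc, ← mul_assoc, he]
  · rw [mul_assoc, he]
  · rw [← mul_assoc, ← mul_assoc, hge, hr, he]
  · rw [← h1, mul_assoc, heg, mul_assoc, hl, he]

theorem isGroupInverse (H : IsLocalInverse e g h) : IsGroupInverse g h :=
  ⟨H.mul_inv.trans H.inv_mul.symm, by rw [H.mul_inv, H.id_mul], by rw [H.inv_mul, H.id_mul_inv]⟩

theorem greenH (H : IsLocalInverse e g h) (K : IsLocalInverse e d k) : GreenH g d :=
  ⟨⟨.inr ⟨g * k, by rw [mul_assoc, K.inv_mul, H.mul_id]⟩,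
    .inr ⟨d * h, by rw [mul_assoc, H.inv_mul, K.mul_id]⟩⟩,
   ⟨.inr ⟨k * g, by rw [← mul_assoc, K.mul_inv, H.id_mul]⟩,
    .inr ⟨h * d, by rw [← mul_assoc, H.mul_inv, K.id_mul]⟩⟩⟩

end IsLocalInverse

/-- In a straight weak left order every `q` is `c * b` with `c` the group inverse of some `a ∈ S`,
`b ∈ S` being `H`-related to `q`; the relations are recorded by explicit multipliers. -/
theorem IsStraightWeakLeftOrder.exists_greenH [Semigroup Q] {S : Set Q}
    (hS : IsStraightWeakLeftOrder S) (q : Q) :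
    ∃ a ∈ S, ∃ b ∈ S, ∃ c u v w : Q,
      a * q = b ∧ c * b = q ∧ a = b * w ∧ q = b * u ∧ b = q * v := by
  obtain ⟨a, ha, b, hb, ⟨c, ⟨h1, h2, h3⟩, hq⟩, hR⟩ := hS q
  obtain ⟨w, hw⟩ : ∃ w, a = b * w := by
    rcases hR.1 with h | h
    · exact ⟨c * a, by rw [← h, ← mul_assoc, h2]⟩
    · exact h
  obtain ⟨y, hy⟩ : ∃ y, b = a * y := by
    rcases hR.2 with h | h
    · exact ⟨c * a, by rw [h, ← mul_assoc, h2]⟩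
    · exact h
  refine ⟨a, ha, b, hb, c, w * c * c * b, w * b, w, ?_, hq.symm, hw, ?_, ?_⟩
  · rw [hq, hy, ← mul_assoc, ← mul_assoc, h2]
  · calc q = c * a * c * b := by rw [h3, hq]
      _ = a * c * c * b := by rw [h1]
      _ = b * w * c * c * b := by rw [← hw]
      _ = _ := by simp only [mul_assoc]
  · calc b = a * c * a * y := by rw [h2, hy]
      _ = c * a * (a * y) := by rw [h1, mul_assoc]
      _ = c * a * b := by rw [← hy]
      _ = c * (b * w) * b := by rw [← hw]
      _ = _ := by rw [hq]; simp only [mul_assoc]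

theorem IsStraightWeakLeftOrder.isStraightWeakRightOrder [Semigroup Q] (hQ : Regular Q)
    (habel : ∀ a b : Q, inSubgroup a → GreenH a b → a * b = b * a)
    {S : Subsemigroup Q} (hS : IsStraightWeakLeftOrder (S : Set Q)) :
    IsStraightWeakRightOrder (S : Set Q) := by
  intro q
  obtain ⟨x, hx⟩ := hQ q
  obtain ⟨_, -, b, hb, c, u, v, -, hab, hcb, -, hu, hv⟩ := hS.exists_greenH q
  obtain ⟨e, he⟩ : ∃ e, e = x * q := ⟨_, rfl⟩
  have hqe : q * e = q := by rw [he, ← mul_assoc, hx]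
  have hee : e * e = e := by rw [he, mul_assoc, ← mul_assoc q, hx]
  have hbe : b * e = b := by rw [← hab, mul_assoc, hqe]
  obtain ⟨b', hb', heb'⟩ : ∃ b', b' * b = e ∧ e * b' = b' :=
    ⟨e * x * c, by rw [mul_assoc, hcb, mul_assoc, ← he, hee], by simp only [← mul_assoc, hee]⟩
  -- `q = b * g` with `g` in the group of units of `eQe`
  have hbg : b * (b' * q) = q := by
    rw [hu, ← mul_assoc, ← mul_assoc, mul_assoc b, hb', hbe]
  generalize hg : b' * q = g at hbg
  have heg : e * g = g := by rw [← hg, ← mul_assoc, heb']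
  have hge : g * e = g := by rw [← hg, mul_assoc, hqe]
  obtain ⟨h, H⟩ : ∃ h, IsLocalInverse e g h :=
    IsLocalInverse.exists_of_left_right (l := x * b) (r := v) hee heg hge
      (by rw [← hg, mul_assoc, ← hv, hb']) (by rw [mul_assoc, hbg, he])
  obtain ⟨a, ha, d, hd, c', u', v', w, had, hcd, haw, hu', hv'⟩ := hS.exists_greenH g
  have hde : d * e = d := by rw [← had, mul_assoc, hge]
  have hed : e * d = d := by rw [hv', ← mul_assoc, heg]
  obtain ⟨k, K⟩ : ∃ k, IsLocalInverse e d k :=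
    IsLocalInverse.exists_of_left_right (l := h * c') (r := u' * h) hee hed hde
      (by rw [← mul_assoc, ← hu', H.mul_inv]) (by rw [mul_assoc, hcd, H.inv_mul])
  have hcomm : d * g = g * d := habel d g ⟨k, K.isGroupInverse⟩ (K.greenH H)
  have hm : a * d = d * h * d := by
    calc a * d = a * (g * h * d) := by rw [H.mul_inv, hed]
      _ = a * g * h * d := by simp only [mul_assoc]
      _ = d * h * d := by rw [had]
  have M : IsLocalInverse e (a * d) (k * (g * k)) := hm ▸ (K.mul H.symm).mul K
  have hqm : q * (a * d) = b * d * d := by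
    calc q * (a * d) = b * (g * d) * h * d := by rw [hm, ← hbg]; simp only [mul_assoc]
      _ = b * d * (g * h) * d := by rw [← hcomm]; simp only [mul_assoc]
      _ = b * d * d := by rw [H.mul_inv, mul_assoc _ e, hed]
  refine ⟨a * d, S.mul_mem ha hd, b * d * d, S.mul_mem (S.mul_mem hb hd) hd,
    ⟨_, M.isGroupInverse, ?_⟩, .inr ⟨x, ?_⟩, .inr ⟨q, hqm.symm⟩⟩
  · rw [← hqm, mul_assoc, M.mul_inv, hqe]
  · rw [← hqm, ← mul_assoc, ← he, M.id_mul]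

section Opposite

open MulOpposite

variable [Semigroup Q]

theorem leL_op {p q : Q} : leL (op p) (op q) ↔ leR p q := by
  simp [leL, leR, MulOpposite.exists, ← op_mul]

theorem leR_op {p q : Q} : leR (op p) (op q) ↔ leL p q := by
  simp [leL, leR, MulOpposite.exists, ← op_mul]

theorem greenL_op {p q : Q} : GreenL (op p) (op q) ↔ GreenR p q := by
  simp [GreenL, GreenR, leL_op]

theorem greenR_op {p q : Q} : GreenR (op p) (op q) ↔ GreenL p q := by
  simp [GreenL, GreenR, leR_op]

theorem greenH_op {p q : Q} : GreenH (op p) (op q) ↔ GreenH p q := by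
  simp [GreenH, greenL_op, greenR_op, and_comm]

theorem isGroupInverse_op {p q : Q} : IsGroupInverse (op p) (op q) ↔ IsGroupInverse p q := by
  simp [IsGroupInverse, ← op_mul, mul_assoc, eq_comm]

theorem inSubgroup_op {p : Q} : inSubgroup (op p) ↔ inSubgroup p := by
  simp [inSubgroup, MulOpposite.exists, isGroupInverse_op]

theorem Regular.op (hQ : Regular Q) : Regular Qᵐᵒᵖ := fun q ↦ by
  obtain ⟨x, hx⟩ := hQ q.unop
  exact ⟨.op x, unop_injective (by simpa [mul_assoc] using hx)⟩

theorem isStraightWeakLeftOrder_op {S : Subsemigroup Q} :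
    IsStraightWeakLeftOrder (S.op : Set Qᵐᵒᵖ) ↔ IsStraightWeakRightOrder (S : Set Q) := by
  simp [IsStraightWeakLeftOrder, IsStraightWeakRightOrder, MulOpposite.forall,
    MulOpposite.exists, isGroupInverse_op, greenR_op, ← op_mul]

theorem isStraightWeakRightOrder_op {S : Subsemigroup Q} :
    IsStraightWeakRightOrder (S.op : Set Qᵐᵒᵖ) ↔ IsStraightWeakLeftOrder (S : Set Q) := by
  simp [IsStraightWeakLeftOrder, IsStraightWeakRightOrder, MulOpposite.forall,
    MulOpposite.exists, isGroupInverse_op, greenL_op, ← op_mul]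

end Opposite

/-- Corollary 3.2: let `Q` be a regular semigroup all of whose subgroups are abelian
(any two `H`-related elements lying in a group `H`-class commute), and let `S` be a
subsemigroup of `Q`.  Then `S` is a straight weak left order in `Q` if and only if `S`
is a straight weak right order in `Q`. -/
theorem straight_left_iff_right_of_abelian {Q : Type u} [Semigroup Q] (hQ : Regular Q)
    (habel : ∀ a b : Q, inSubgroup a → GreenH a b → a * b = b * a)
    (S : Subsemigroup Q) :
    IsStraightWeakLeftOrder (S : Set Q) ↔ IsStraightWeakRightOrder (S : Set Q) := by
  refine ⟨fun h ↦ h.isStraightWeakRightOrder hQ habel, fun h ↦ isStraightWeakRightOrder_op.1 <|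
    (isStraightWeakLeftOrder_op.2 h).isStraightWeakRightOrder hQ.op fun a b ha hab ↦ ?_⟩
  exact MulOpposite.unop_injective
    (habel a.unop b.unop (inSubgroup_op.1 ha) (greenH_op.1 hab)).symm
end

section
/- Let Q be a regular semigroup on which Green's relation H is a congruence. Then every weak left order in Q is a straight weak left order in Q. -/
universe u

variable {Q : Type u}

/-- An element of a group `H`-class is `H`-related to its group inverse. -/
theorem IsGroupInverse.greenH {Q : Type u} [Semigroup Q] {a c : Q} (h : IsGroupInverse a c) :
    GreenH c a := by
  obtain ⟨hc, h1, h2⟩ := h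
  refine ⟨⟨.inr ⟨c * c, ?_⟩, .inr ⟨a * a, ?_⟩⟩, ⟨.inr ⟨c * c, ?_⟩, .inr ⟨a * a, ?_⟩⟩⟩
  · rw [mul_assoc, ← hc, ← mul_assoc, h2]
  · rw [mul_assoc, hc, ← mul_assoc, h1]
  · rw [← mul_assoc, hc, h2]
  · rw [← mul_assoc, ← hc, h1]

theorem GreenH.refl {Q : Type u} [Semigroup Q] (a : Q) : GreenH a a :=
  ⟨⟨.inl rfl, .inl rfl⟩, ⟨.inl rfl, .inl rfl⟩⟩

theorem leL.mul_of_idempotent {Q : Type u} [Semigroup Q] {x g : Q} (hg : g * g = g)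
    (h : leL x g) : x * g = x := by
  obtain rfl | ⟨u, rfl⟩ := h
  · exact hg
  · rw [mul_assoc, hg]

theorem leR.mul_of_idempotent {Q : Type u} [Semigroup Q] {x g : Q} (hg : g * g = g)
    (h : leR x g) : g * x = x := by
  obtain rfl | ⟨u, rfl⟩ := h
  · exact hg
  · rw [← mul_assoc, hg]

/-- An element `H`-related to an idempotent `g` has a group inverse with respect to `g`. -/
theorem GreenH.exists_isGroupInverse {Q : Type u} [Semigroup Q] {x g : Q} (hg : g * g = g)
    (h : GreenH x g) : ∃ c, IsGroupInverse x c ∧ c * x = g := by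
  obtain ⟨⟨hL, hL'⟩, hR, hR'⟩ := h
  have hxg := hL.mul_of_idempotent hg
  have hgx := hR.mul_of_idempotent hg
  obtain ⟨u, hu⟩ : ∃ u, u * x = g := by
    obtain rfl | ⟨u, hu⟩ := hL'
    · exact ⟨g, hg⟩
    · exact ⟨u, hu.symm⟩
  obtain ⟨v, hv⟩ : ∃ v, x * v = g := by
    obtain rfl | ⟨v, hv⟩ := hR'
    · exact ⟨g, hg⟩
    · exact ⟨v, hv.symm⟩
  have huv : u * g = g * v := by rw [← hv, ← mul_assoc, hu, hv]
  have hxc : x * (g * v) = g := by rw [← mul_assoc, hxg, hv]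
  have hcx : g * v * x = g := by rw [← huv, mul_assoc, hgx, hu]
  refine ⟨g * v, ⟨hxc.trans hcx.symm, ?_, ?_⟩, hcx⟩
  · rw [hxc, hgx]
  · rw [hcx, ← mul_assoc, hg]

/-- If `H` is a congruence, then every weak left order meets every `H`-class. -/
theorem IsWeakLeftOrder.veryLarge {Q : Type u} [Semigroup Q]
    (hcong : ∀ a b c d : Q, GreenH a b → GreenH c d → GreenH (a * c) (b * d))
    {S : Subsemigroup Q} (hS : IsWeakLeftOrder (S : Set Q)) : VeryLarge (S : Set Q) := by
  intro q
  obtain ⟨a, ha, b, hb, c, hc, rfl⟩ := hS q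
  obtain ⟨⟨h1, h2⟩, h3, h4⟩ := hc.greenH
  exact ⟨a * b, S.mul_mem ha hb, hcong _ _ _ _ ⟨⟨h2, h1⟩, h4, h3⟩ (GreenH.refl b)⟩

/-- Corollary 3.3: let `Q` be a regular semigroup on which Green's relation `H` is a
congruence.  Then every weak left order in `Q` is a straight weak left order in `Q`. -/
theorem weak_left_order_straight_of_H_congruence {Q : Type u} [Semigroup Q]
    (hQ : Regular Q)
    (hcong : ∀ a b c d : Q, GreenH a b → GreenH c d → GreenH (a * c) (b * d))
    (S : Subsemigroup Q) (hS : IsWeakLeftOrder (S : Set Q)) :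
    IsStraightWeakLeftOrder (S : Set Q) := by
  intro q
  obtain ⟨a, ha, b, hb, a', ha', hq⟩ := hS q
  obtain ⟨x, hx⟩ := hQ q
  have haa : a * a' * (a * a') = a * a' := by rw [← mul_assoc, ha'.2.1]
  have heq : a * a' * q = q := by rw [hq, ← mul_assoc, ha'.1, ha'.2.2]
  obtain ⟨g, hg⟩ : ∃ g, g = q * (x * (a * a')) := ⟨_, rfl⟩
  have hgq : g * q = q := by rw [hg, mul_assoc, mul_assoc, heq, ← mul_assoc, hx]
  have hgg : g * g = g := by
    nth_rw 2 [hg]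
    rw [← mul_assoc, hgq, hg]
  have hge : g * (a * a') = g := by rw [hg, mul_assoc, mul_assoc, haa]
  obtain ⟨s, hs, hsg⟩ := hS.veryLarge hcong g
  have hse : s * (a * a') = s := by
    rw [← hsg.1.1.mul_of_idempotent hgg, mul_assoc, hge]
  have hae : GreenH a (a * a') :=
    ⟨⟨.inr ⟨a, by rw [ha'.1, ← mul_assoc, ha'.2.1]⟩, .inr ⟨a', ha'.1⟩⟩,
      .inr ⟨a, ha'.2.1.symm⟩, .inr ⟨a', rfl⟩⟩
  have hsag : GreenH (s * a) g := by
    have := hcong _ _ _ _ hsg hae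
    rwa [hge] at this
  have hsaq : s * a * q = s * b := by
    rw [hq, ← mul_assoc, mul_assoc s a a', hse]
  obtain ⟨c, hc, hcg⟩ := hsag.exists_isGroupInverse hgg
  refine ⟨s * a, S.mul_mem hs ha, s * b, S.mul_mem hs hb, ⟨c, hc, ?_⟩, ?_, ?_⟩
  · rw [← hsaq, ← mul_assoc, hcg, hgq]
  · refine .inr ⟨x * (a * a'), ?_⟩
    rw [← hsaq, mul_assoc (s * a) q, ← hg, hsag.1.1.mul_of_idempotent hgg]
  · exact .inr ⟨q, hsaq.symm⟩
end

section
/- Let P = (≤_l, ≤_r) be a *-pair for a semigroup S satisfying condition (Ev) (both the left and right versions). Then for all a,b ∈ S: (i) if a ∈ G(S) and a L' b, then ba H' b; (ii) if a ∈ G(S) and a R' b, then ab H' b; (iii) if a ∈ G(S), then the H'-class H'_a is a subsemigroup of S and H'_a ⊆ G(S). -/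
universe u

variable {S : Type u}

/-- `a ≤_{L*} b` in a semigroup `S`: for all `x, y ∈ S¹`, `bx = by` implies `ax = ay`. -/
def leLstar [Semigroup S] (a b : S) : Prop :=
  ∀ x y : WithOne S, (b : WithOne S) * x = (b : WithOne S) * y →
    (a : WithOne S) * x = (a : WithOne S) * y

/-- `a ≤_{R*} b` in a semigroup `S`: for all `x, y ∈ S¹`, `xb = yb` implies `xa = ya`. -/
def leRstar [Semigroup S] (a b : S) : Prop :=
  ∀ x y : WithOne S, x * (b : WithOne S) = y * (b : WithOne S) →
    x * (a : WithOne S) = y * (a : WithOne S)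

/-- `a` is square cancellable: `a H* a²`, i.e. `a L* a²` and `a R* a²`. -/
def SqC [Semigroup S] (a : S) : Prop :=
  leLstar a (a * a) ∧ leLstar (a * a) a ∧ leRstar a (a * a) ∧ leRstar (a * a) a

/-- `S(S)`, the set of square cancellable elements of `S`. -/
def SqSet (S : Type u) [Semigroup S] : Set S := { a | SqC a }

/-- `(lel, ler)` is a `*`-pair for `S`: both are preorders, `lel` is right compatible
with multiplication, `ler` is left compatible, `lel ⊆ ≤_{L*}` and `ler ⊆ ≤_{R*}`. -/
def IsStarPair [Semigroup S] (lel ler : S → S → Prop) : Prop :=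
  (∀ a, lel a a) ∧ (∀ a b c, lel a b → lel b c → lel a c) ∧
  (∀ a, ler a a) ∧ (∀ a b c, ler a b → ler b c → ler a c) ∧
  (∀ a b c, lel a b → lel (a * c) (b * c)) ∧
  (∀ a b c, ler a b → ler (c * a) (c * b)) ∧
  (∀ a b, lel a b → leLstar a b) ∧
  (∀ a b, ler a b → leRstar a b)

/-- The equivalence `L'` associated with `lel`. -/
def Lp [Semigroup S] (lel : S → S → Prop) (a b : S) : Prop := lel a b ∧ lel b a

/-- The equivalence `R'` associated with `ler`. -/
def Rp [Semigroup S] (ler : S → S → Prop) (a b : S) : Prop := ler a b ∧ ler b a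

/-- `H' = L' ∩ R'`. -/
def Hp [Semigroup S] (lel ler : S → S → Prop) (a b : S) : Prop :=
  Lp lel a b ∧ Rp ler a b

/-- `G(S) = { a ∈ S : a H' a² }`. -/
def GS [Semigroup S] (lel ler : S → S → Prop) : Set S := { a | Hp lel ler a (a * a) }

/-- Condition (Ei): `L' ∘ R' = R' ∘ L'`. -/
def CondEi [Semigroup S] (lel ler : S → S → Prop) : Prop :=
  ∀ a b : S, (∃ c, Lp lel a c ∧ Rp ler c b) ↔ (∃ c, Rp ler a c ∧ Lp lel c b)

/-- Condition (Eii)(l): `b ≤_l c` iff `b L' dc` for some `d ∈ S`. -/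
def CondEiiL [Semigroup S] (lel : S → S → Prop) : Prop :=
  ∀ b c : S, lel b c ↔ ∃ d, Lp lel b (d * c)

/-- Condition (Eii)(r): `b ≤_r c` iff `b R' cd` for some `d ∈ S`. -/
def CondEiiR [Semigroup S] (ler : S → S → Prop) : Prop :=
  ∀ b c : S, ler b c ↔ ∃ d, Rp ler b (c * d)

/-- Condition (Eiii): every `L'`-class and every `R'`-class contains an element of
`G(S)`. -/
def CondEiii [Semigroup S] (lel ler : S → S → Prop) : Prop :=
  (∀ a : S, ∃ g ∈ GS lel ler, Lp lel a g) ∧ (∀ a : S, ∃ g ∈ GS lel ler, Rp ler a g)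

/-- Condition (Ev)(l): for `a ∈ G(S)` and `b ∈ S`, `b ≤_l a` implies `ba R' b`. -/
def CondEvL [Semigroup S] (lel ler : S → S → Prop) : Prop :=
  ∀ a ∈ GS lel ler, ∀ b : S, lel b a → Rp ler (b * a) b

/-- Condition (Ev)(r): for `a ∈ G(S)` and `b ∈ S`, `b ≤_r a` implies `ab L' b`. -/
def CondEvR [Semigroup S] (lel ler : S → S → Prop) : Prop :=
  ∀ a ∈ GS lel ler, ∀ b : S, ler b a → Lp lel (a * b) b

/-- Condition (Evi)(l): for `a ∈ G(S)`, `b, c ≤_l a` and `ba = ca` imply `b = c`. -/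
def CondEviL [Semigroup S] (lel ler : S → S → Prop) : Prop :=
  ∀ a ∈ GS lel ler, ∀ b c : S, lel b a → lel c a → b * a = c * a → b = c

/-- Condition (Evi)(r): for `a ∈ G(S)`, `b, c ≤_r a` and `ab = ac` imply `b = c`. -/
def CondEviR [Semigroup S] (lel ler : S → S → Prop) : Prop :=
  ∀ a ∈ GS lel ler, ∀ b c : S, ler b a → ler c a → a * b = a * c → b = c

/-- Condition (Evii)(l): for `a ∈ G(S)`, `b, c ≤_l a` and `ba L' ca` imply `b L' c`. -/
def CondEviiL [Semigroup S] (lel ler : S → S → Prop) : Prop :=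
  ∀ a ∈ GS lel ler, ∀ b c : S, lel b a → lel c a → Lp lel (b * a) (c * a) → Lp lel b c

/-- Condition (Evii)(r): for `a ∈ G(S)`, `b, c ≤_r a` and `ab R' ac` imply `b R' c`. -/
def CondEviiR [Semigroup S] (lel ler : S → S → Prop) : Prop :=
  ∀ a ∈ GS lel ler, ∀ b c : S, ler b a → ler c a → Rp ler (a * b) (a * c) → Rp ler b c

/-- An embeddable `*`-pair: a `*`-pair satisfying (Ei), (Eii), (Eiii), (Ev), (Evi) and
(Evii) (left and right versions). -/
def IsEmbeddableStarPair [Semigroup S] (lel ler : S → S → Prop) : Prop :=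
  IsStarPair lel ler ∧ CondEi lel ler ∧ CondEiiL lel ∧ CondEiiR ler ∧
  CondEiii lel ler ∧ CondEvL lel ler ∧ CondEvR lel ler ∧
  CondEviL lel ler ∧ CondEviR lel ler ∧ CondEviiL lel ler ∧ CondEviiR lel ler

/-- Condition (Gi): `S(S) = G(S)`. -/
def CondGi [Semigroup S] (lel ler : S → S → Prop) : Prop := SqSet S = GS lel ler

/-- Condition (Gii): for every square cancellable `a`, the `H'`-class of `a` is right
reversible: for all `x, y H' a` there exist `u, v H' a` with `ux = vy`. -/
def CondGii [Semigroup S] (lel ler : S → S → Prop) : Prop :=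
  ∀ a ∈ SqSet S, ∀ x y : S, Hp lel ler x a → Hp lel ler y a →
    ∃ u v : S, Hp lel ler u a ∧ Hp lel ler v a ∧ u * x = v * y

/-- Condition (Gii)': for every square cancellable `a`, the `H'`-class of `a` is left
reversible: for all `x, y H' a` there exist `u, v H' a` with `xu = yv`. -/
def CondGii' [Semigroup S] (lel ler : S → S → Prop) : Prop :=
  ∀ a ∈ SqSet S, ∀ x y : S, Hp lel ler x a → Hp lel ler y a →
    ∃ u v : S, Hp lel ler u a ∧ Hp lel ler v a ∧ x * u = y * v

/-- Lemma 4.5: let `(lel, ler)` be a `*`-pair for a semigroup `S` satisfying (Ev) (both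
versions).  Then for all `a, b ∈ S`:
(i) if `a ∈ G(S)` and `a L' b`, then `ba H' b`;
(ii) if `a ∈ G(S)` and `a R' b`, then `ab H' b`;
(iii) if `a ∈ G(S)`, then `H'_a` is a subsemigroup of `S` contained in `G(S)`. -/
theorem starpair_Ev_lemma {S : Type u} [Semigroup S] (lel ler : S → S → Prop)
    (hP : IsStarPair lel ler) (hEvL : CondEvL lel ler) (hEvR : CondEvR lel ler) :
    (∀ a b : S, a ∈ GS lel ler → Lp lel a b → Hp lel ler (b * a) b) ∧
    (∀ a b : S, a ∈ GS lel ler → Rp ler a b → Hp lel ler (a * b) b) ∧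
    (∀ a : S, a ∈ GS lel ler →
      (∀ b c : S, Hp lel ler b a → Hp lel ler c a → Hp lel ler (b * c) a) ∧
      (∀ b : S, Hp lel ler b a → b ∈ GS lel ler)) := by
  obtain ⟨-, htl, -, htr, hcl, hcr, -, -⟩ := hP
  have mul_closed : ∀ a ∈ GS lel ler, ∀ b c : S, Hp lel ler b a → Hp lel ler c a →
      Hp lel ler (b * c) a := by
    rintro a ha b c ⟨⟨hba, hab⟩, ⟨hba', hab'⟩⟩ ⟨⟨hca, hac⟩, ⟨hca', hac'⟩⟩
    obtain ⟨hl₁, hl₂⟩ := hEvR a ha c hca'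
    obtain ⟨hr₁, hr₂⟩ := hEvL a ha b hba
    exact ⟨⟨htl _ _ _ (hcl _ _ c hba) (htl _ _ _ hl₁ hca),
        htl _ _ _ (htl _ _ _ hac hl₂) (hcl _ _ c hab)⟩,
      ⟨htr _ _ _ (hcr _ _ b hca') (htr _ _ _ hr₁ hba'),
        htr _ _ _ (htr _ _ _ hab' hr₂) (hcr _ _ b hac')⟩⟩
  refine ⟨?_, ?_, fun a ha => ⟨mul_closed a ha, fun b hb => ?_⟩⟩
  · rintro a b ha ⟨hab, hba⟩
    exact ⟨⟨htl _ _ _ (hcl _ _ a hba) (htl _ _ _ ha.1.2 hab),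
      htl _ _ _ hba (htl _ _ _ ha.1.1 (hcl _ _ a hab))⟩, hEvL a ha b hba⟩
  · rintro a b ha ⟨hab, hba⟩
    exact ⟨hEvR a ha b hba, ⟨htr _ _ _ (hcr _ _ a hba) (htr _ _ _ ha.2.2 hab),
      htr _ _ _ hba (htr _ _ _ ha.2.1 (hcr _ _ a hab))⟩⟩
  · have hbb := mul_closed a ha b b hb hb
    exact ⟨⟨htl _ _ _ hb.1.1 hbb.1.2, htl _ _ _ hbb.1.1 hb.1.2⟩,
      ⟨htr _ _ _ hb.2.1 hbb.2.2, htr _ _ _ hbb.2.1 hb.2.2⟩⟩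
end

section
/- Let P = (≤_l, ≤_r) be a *-pair for a semigroup S satisfying condition (Ev) (both the left and right versions). Then for all u,v ∈ S, if u L' s R' v for some s ∈ G(S), then u R' uv and uv L' v. -/
universe u

variable {S : Type u}

/-- Corollary 4.6: let `(lel, ler)` be a `*`-pair for a semigroup `S` satisfying (Ev)
(both versions).  Then for all `u, v ∈ S`, if `u L' s R' v` for some `s ∈ G(S)`, then
`u R' uv` and `uv L' v`. -/
theorem starpair_green_lemma {S : Type u} [Semigroup S] (lel ler : S → S → Prop)
    (hP : IsStarPair lel ler) (hEvL : CondEvL lel ler) (hEvR : CondEvR lel ler) :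
    ∀ u v s : S, s ∈ GS lel ler → Lp lel u s → Rp ler s v →
      Rp ler u (u * v) ∧ Lp lel (u * v) v := by
  obtain ⟨-, hl_trans, -, hr_trans, hl_mul, hr_mul, -, -⟩ := hP
  rintro u v s hs ⟨hus, hsu⟩ ⟨hsv, hvs⟩
  obtain ⟨hle_u, hu_le⟩ := hEvL s hs u hus
  obtain ⟨hle_v, hv_le⟩ := hEvR s hs v hvs
  exact ⟨⟨hr_trans _ _ _ hu_le (hr_mul _ _ u hsv), hr_trans _ _ _ (hr_mul _ _ u hvs) hle_u⟩,
    hl_trans _ _ _ (hl_mul _ _ v hus) hle_v, hl_trans _ _ _ hv_le (hl_mul _ _ v hsu)⟩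
end

section
/- Let P = (≤_l, ≤_r) be a *-pair for a semigroup S satisfying conditions (Ei), (Eii), (Eiii), (Ev), (Evi)(l) and (Gii). Then for any b,c ∈ S, b ≤_l c if and only if there exist h ∈ G(S) and k ∈ S with hb = kc and h R' k R' b. -/
universe u

variable {S : Type u}

section StarPair

variable [Semigroup S] {lel ler : S → S → Prop}

theorem Lp.symm {a b : S} (h : Lp lel a b) : Lp lel b a := ⟨h.2, h.1⟩

theorem Rp.symm {a b : S} (h : Rp ler a b) : Rp ler b a := ⟨h.2, h.1⟩

theorem Hp.symm {a b : S} (h : Hp lel ler a b) : Hp lel ler b a := ⟨h.1.symm, h.2.symm⟩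

namespace IsStarPair

theorem lp_trans (hP : IsStarPair lel ler) {a b c : S} (h : Lp lel a b) (h' : Lp lel b c) :
    Lp lel a c :=
  ⟨hP.2.1 _ _ _ h.1 h'.1, hP.2.1 _ _ _ h'.2 h.2⟩

theorem rp_trans (hP : IsStarPair lel ler) {a b c : S} (h : Rp ler a b) (h' : Rp ler b c) :
    Rp ler a c :=
  ⟨hP.2.2.2.1 _ _ _ h.1 h'.1, hP.2.2.2.1 _ _ _ h'.2 h.2⟩

theorem hp_trans (hP : IsStarPair lel ler) {a b c : S} (h : Hp lel ler a b)
    (h' : Hp lel ler b c) : Hp lel ler a c :=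
  ⟨hP.lp_trans h.1 h'.1, hP.rp_trans h.2 h'.2⟩

theorem lp_mul_right (hP : IsStarPair lel ler) {a b : S} (h : Lp lel a b) (c : S) :
    Lp lel (a * c) (b * c) :=
  ⟨hP.2.2.2.2.1 _ _ _ h.1, hP.2.2.2.2.1 _ _ _ h.2⟩

theorem rp_mul_left (hP : IsStarPair lel ler) {a b : S} (h : Rp ler a b) (c : S) :
    Rp ler (c * a) (c * b) :=
  ⟨hP.2.2.2.2.2.1 _ _ _ h.1, hP.2.2.2.2.2.1 _ _ _ h.2⟩

theorem mul_lel (hP : IsStarPair lel ler) (hEiiL : CondEiiL lel) (a b : S) : lel (a * b) b :=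
  (hEiiL _ _).2 ⟨a, hP.1 _, hP.1 _⟩

theorem mul_ler (hP : IsStarPair lel ler) (hEiiR : CondEiiR ler) (a b : S) : ler (a * b) a :=
  (hEiiR _ _).2 ⟨b, hP.2.2.1 _, hP.2.2.1 _⟩

theorem mul_right_cancel (hP : IsStarPair lel ler) {a b x y : S} (h : ler b a)
    (hxy : x * a = y * a) : x * b = y * b := by
  have := hP.2.2.2.2.2.2.2 _ _ h x y (by exact_mod_cast hxy)
  exact_mod_cast this

/-- Every element of `G(S)` is square cancellable. -/
theorem sqC_of_mem_GS (hP : IsStarPair lel ler) {a : S} (ha : a ∈ GS lel ler) : SqC a :=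
  have hl := hP.2.2.2.2.2.2.1
  have hr := hP.2.2.2.2.2.2.2
  ⟨hl _ _ ha.1.1, hl _ _ ha.1.2, hr _ _ ha.2.1, hr _ _ ha.2.2⟩

/-- A product `x * y` such that `L'_x ∩ R'_y` contains an element of `G(S)` lies in
`R'_x ∩ L'_y`. -/
theorem mul_lp_rp (hP : IsStarPair lel ler) (hEvL : CondEvL lel ler) (hEvR : CondEvR lel ler)
    {g x y : S} (hg : g ∈ GS lel ler) (hx : Lp lel x g) (hy : Rp ler y g) :
    Lp lel (x * y) y ∧ Rp ler (x * y) x :=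
  ⟨hP.lp_trans (hP.lp_mul_right hx y) (hEvR g hg y hy.1),
    hP.rp_trans (hP.rp_mul_left hy x) (hEvL g hg x hx.1)⟩

/-- The set `G(S)` is a union of `H'`-classes. -/
theorem mem_GS_of_hp (hP : IsStarPair lel ler) (hEvL : CondEvL lel ler)
    (hEvR : CondEvR lel ler) {g x : S} (hg : g ∈ GS lel ler) (hx : Hp lel ler x g) :
    x ∈ GS lel ler :=
  Hp.symm (hP.mul_lp_rp hEvL hEvR hg hx.1 hx.2)

/-- If `b ≤_l c`, then `b H' dc` for some `d`. -/
theorem exists_hp_mul (hP : IsStarPair lel ler) (hEi : CondEi lel ler)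
    (hEiiL : CondEiiL lel) (hEiii : CondEiii lel ler) (hEvL : CondEvL lel ler)
    (hEvR : CondEvR lel ler) {b c : S} (hbc : lel b c) : ∃ d, Hp lel ler (d * c) b := by
  obtain ⟨d, hd⟩ := (hEiiL b c).1 hbc
  obtain ⟨u, hu, hdu⟩ := hEiii.2 (d * c)
  obtain ⟨s, hbs, hsu⟩ := (hEi b u).1 ⟨d * c, hd, hdu⟩
  obtain ⟨h₁, h₂⟩ := hP.mul_lp_rp hEvL hEvR hu hsu hdu
  rw [← mul_assoc] at h₁ h₂
  exact ⟨s * d, hP.lp_trans h₁ hd.symm, hP.rp_trans h₂ hbs.symm⟩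

/-- Right reversibility of the `H'`-class of `g ∈ G(S)` passes to each `H'`-class inside
`R'_g`. -/
theorem exists_mul_eq_mul (hP : IsStarPair lel ler) (hEi : CondEi lel ler)
    (hEiiL : CondEiiL lel) (hEiii : CondEiii lel ler) (hEvL : CondEvL lel ler)
    (hEvR : CondEvR lel ler) (hEviL : CondEviL lel ler) (hGii : CondGii lel ler)
    {g a b : S} (hg : g ∈ GS lel ler) (hbg : Rp ler b g) (hab : Hp lel ler a b) :
    ∃ u v, Hp lel ler u g ∧ Hp lel ler v g ∧ u * b = v * a := by
  obtain ⟨w, hw, hbw⟩ := hEiii.1 b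
  obtain ⟨t, hwt, htg⟩ := (hEi w g).1 ⟨b, hbw.symm, hbg⟩
  have haw := hP.lp_trans hab.1 hbw
  have hag := hP.rp_trans hab.2 hbg
  obtain ⟨h₁, h₂⟩ := hP.mul_lp_rp hEvL hEvR hw hbw hwt.symm
  obtain ⟨h₃, h₄⟩ := hP.mul_lp_rp hEvL hEvR hw haw hwt.symm
  obtain ⟨u, v, hu, hv, huv⟩ := hGii g (hP.sqC_of_mem_GS hg) (b * t) (a * t)
    ⟨hP.lp_trans h₁ htg, hP.rp_trans h₂ hbg⟩ ⟨hP.lp_trans h₃ htg, hP.rp_trans h₄ hag⟩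
  rw [← mul_assoc, ← mul_assoc] at huv
  exact ⟨u, v, hu, hv, hEviL w hw _ _
    (hP.2.1 _ _ _ (hP.mul_lel hEiiL u b) hbw.1) (hP.2.1 _ _ _ (hP.mul_lel hEiiL v a) haw.1)
    (hP.mul_right_cancel hwt.1 huv)⟩

end IsStarPair

end StarPair

/-- Lemma 4.7: let `(lel, ler)` be a `*`-pair for a semigroup `S` satisfying (Ei),
(Eii), (Eiii), (Ev), (Evi)(l) and (Gii).  Then for any `b, c ∈ S`, `b ≤_l c` if and
only if `hb = kc` for some `h ∈ G(S)` and `k ∈ S` with `h R' k R' b`. -/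
theorem starpair_leL_iff {S : Type u} [Semigroup S] (lel ler : S → S → Prop)
    (hP : IsStarPair lel ler) (hEi : CondEi lel ler)
    (hEiiL : CondEiiL lel) (hEiiR : CondEiiR ler) (hEiii : CondEiii lel ler)
    (hEvL : CondEvL lel ler) (hEvR : CondEvR lel ler) (hEviL : CondEviL lel ler)
    (hGii : CondGii lel ler) :
    ∀ b c : S, lel b c ↔
      ∃ h ∈ GS lel ler, ∃ k : S, h * b = k * c ∧ Rp ler h k ∧ Rp ler k b := by
  intro b c
  constructor
  · intro hbc
    obtain ⟨d, hd⟩ := hP.exists_hp_mul hEi hEiiL hEiii hEvL hEvR hbc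
    obtain ⟨g, hg, hbg⟩ := hEiii.2 b
    obtain ⟨u, v, hu, hv, huv⟩ :=
      hP.exists_mul_eq_mul hEi hEiiL hEiii hEvL hEvR hEviL hGii hg hbg hd
    have hvb : Rp ler v b := hP.rp_trans hv.2 hbg.symm
    have hvdc : Rp ler (v * d * c) v := by
      rw [mul_assoc]
      exact (hP.mul_lp_rp hEvL hEvR hg hv.1 (hP.rp_trans hd.2 hbg)).2
    have hvd : Rp ler (v * d) v :=
      ⟨hP.mul_ler hEiiR v d, hP.2.2.2.1 _ _ _ hvdc.2 (hP.mul_ler hEiiR (v * d) c)⟩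
    exact ⟨u, hP.mem_GS_of_hp hEvL hEvR hg hu, v * d, by rw [huv, mul_assoc],
      hP.rp_trans (hP.rp_trans hu.2 hv.2.symm) hvd.symm, hP.rp_trans hvd hvb⟩
  · rintro ⟨h, hh, k, hk, hhk, hkb⟩
    refine (hEiiL b c).2 ⟨k, ?_⟩
    rw [← hk]
    exact (hEvR h hh b (hP.rp_trans hhk hkb).2).symm
end

section
/- Let P = (≤_l, ≤_r) be a *-pair for a semigroup S satisfying conditions (Ei), (Eii), (Eiii), (Ev), (Evi)(l) and (Gii). Then P also satisfies condition (Evii)(l): for all a ∈ G(S) and b,c ∈ S, if b ≤_l a, c ≤_l a and ba L' ca, then b L' c. -/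
universe u

variable {S : Type u}

/-- The relation `L'` associated with a preorder is an equivalence. -/
theorem Lp_equivalence [Semigroup S] {lel : S → S → Prop} (hrefl : ∀ a, lel a a)
    (htrans : ∀ a b c, lel a b → lel b c → lel a c) : Equivalence (Lp lel) :=
  ⟨fun a => ⟨hrefl a, hrefl a⟩, fun h => ⟨h.2, h.1⟩,
    fun h k => ⟨htrans _ _ _ h.1 k.1, htrans _ _ _ k.2 h.2⟩⟩

theorem Rp_equivalence [Semigroup S] {ler : S → S → Prop} (hrefl : ∀ a, ler a a)
    (htrans : ∀ a b c, ler a b → ler b c → ler a c) : Equivalence (Rp ler) :=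
  Lp_equivalence (lel := ler) hrefl htrans

theorem GS_subset_SqSet [Semigroup S] {lel ler : S → S → Prop} (hP : IsStarPair lel ler) :
    GS lel ler ⊆ SqSet S := by
  obtain ⟨-, -, -, -, -, -, hL, hR⟩ := hP
  exact fun a ha => ⟨hL _ _ ha.1.1, hL _ _ ha.1.2, hR _ _ ha.2.1, hR _ _ ha.2.2⟩

/-- If `k ∈ G(S)` and `x L' k`, then `x` can be moved into `H'_k` by multiplying on the left
by some `w R' k` such that `w` is `L'`-related to an element of `G(S) ∩ R'_x`. -/
theorem exists_mul_Hp [Semigroup S] {lel ler : S → S → Prop}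
    (hP : IsStarPair lel ler) (hEi : CondEi lel ler) (hEiii : CondEiii lel ler)
    (hEvL : CondEvL lel ler) (hEvR : CondEvR lel ler) {x k : S} (hxk : Lp lel x k) :
    ∃ g ∈ GS lel ler, ∃ w, Rp ler x g ∧ Lp lel w g ∧ Rp ler w k ∧
      Hp lel ler (w * x) k := by
  obtain ⟨hlr, hlt, hrr, hrt, hcl, hcr, -, -⟩ := hP
  have eL := Lp_equivalence hlr hlt
  have eR := Rp_equivalence hrr hrt
  obtain ⟨g, hg, hxg⟩ := hEiii.2 x
  obtain ⟨w, hgw, hwk⟩ := (hEi g k).2 ⟨x, eR.symm hxg, hxk⟩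
  have hgx : Lp lel (g * x) x := hEvR g hg x hxg.1
  have hwx : Lp lel (w * x) (g * x) := ⟨hcl _ _ _ hgw.2, hcl _ _ _ hgw.1⟩
  have hwg : Rp ler (w * x) (w * g) := ⟨hcr _ _ _ hxg.1, hcr _ _ _ hxg.2⟩
  exact ⟨g, hg, w, hxg, eL.symm hgw, hwk, eL.trans hwx (eL.trans hgx hxk),
    eR.trans hwg (eR.trans (hEvL g hg w hgw.2) hwk)⟩

/-- `L'`-related elements have a common left multiple `u * x = v * y`, where `u` and `v`
preserve the `L'`-classes of all elements of `R'_x` and `R'_y` respectively. -/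
theorem exists_mul_eq_mul_of_Lp [Semigroup S] {lel ler : S → S → Prop}
    (hP : IsStarPair lel ler) (hEi : CondEi lel ler) (hEiii : CondEiii lel ler)
    (hEvL : CondEvL lel ler) (hEvR : CondEvR lel ler) (hGii : CondGii lel ler)
    {x y : S} (hxy : Lp lel x y) :
    ∃ u v : S, u * x = v * y ∧ (∀ b, Rp ler x b → Lp lel (u * b) b) ∧
      ∀ c, Rp ler y c → Lp lel (v * c) c := by
  obtain ⟨k, hk, hxk⟩ := hEiii.1 x
  have hkS := GS_subset_SqSet hP hk
  have eL := Lp_equivalence hP.1 hP.2.1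
  have eR := Rp_equivalence hP.2.2.1 hP.2.2.2.1
  have hcl := hP.2.2.2.2.1
  have key : ∀ {x g w u : S}, g ∈ GS lel ler → Rp ler x g → Lp lel w g → Rp ler w k →
      Hp lel ler u k → ∀ b, Rp ler x b → Lp lel (u * w * b) b := by
    intro x g w u hg hxg hwg hwk huk b hxb
    have h₁ : Lp lel (u * w) (k * w) := ⟨hcl _ _ _ huk.1.1, hcl _ _ _ huk.1.2⟩
    have h₂ := eL.trans h₁ (eL.trans (hEvR k hk w hwk.1) hwg)
    have h₃ : Lp lel (u * w * b) (g * b) := ⟨hcl _ _ _ h₂.1, hcl _ _ _ h₂.2⟩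
    exact eL.trans h₃ (hEvR g hg b (eR.trans (eR.symm hxb) hxg).1)
  obtain ⟨g, hg, w, hxg, hwg, hwk, hwx⟩ := exists_mul_Hp hP hEi hEiii hEvL hEvR hxk
  obtain ⟨h, hh, z, hyh, hzh, hzk, hzy⟩ :=
    exists_mul_Hp hP hEi hEiii hEvL hEvR (eL.trans (eL.symm hxy) hxk)
  obtain ⟨u, v, huk, hvk, huv⟩ := hGii k hkS _ _ hwx hzy
  exact ⟨u * w, v * z, by simpa only [mul_assoc] using huv,
    key hg hxg hwg hwk huk, key hh hyh hzh hzk hvk⟩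

/-- Lemma 4.11: let `(lel, ler)` be a `*`-pair for a semigroup `S` satisfying (Ei),
(Eii), (Eiii), (Ev), (Evi)(l) and (Gii).  Then it also satisfies (Evii)(l). -/
theorem starpair_EviiL {S : Type u} [Semigroup S] (lel ler : S → S → Prop)
    (hP : IsStarPair lel ler) (hEi : CondEi lel ler)
    (hEiiL : CondEiiL lel) (hEiiR : CondEiiR ler) (hEiii : CondEiii lel ler)
    (hEvL : CondEvL lel ler) (hEvR : CondEvR lel ler) (hEviL : CondEviL lel ler)
    (hGii : CondGii lel ler) :
    CondEviiL lel ler := by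
  intro a ha b c hba hca hbc
  obtain ⟨u, v, huv, hu, hv⟩ := exists_mul_eq_mul_of_Lp hP hEi hEiii hEvL hEvR hGii hbc
  have hub := hu b (hEvL a ha b hba)
  have hvc := hv c (hEvL a ha c hca)
  have eL := Lp_equivalence hP.1 hP.2.1
  have heq : u * b = v * c :=
    hEviL a ha _ _ (hP.2.1 _ _ _ hub.1 hba) (hP.2.1 _ _ _ hvc.1 hca)
      (by simpa only [mul_assoc] using huv)
  exact eL.trans (eL.symm hub) (heq ▸ hvc)
end
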